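/- arXiv:2404.16320 — 2 statements merged into one kernel-verified Lean document; each statement's English description precedes it below -/
import Mathlib

section
/- Let f be a bounded measurable function on the d-dimensional torus T^d with mean zero, and let α > 0. For ε = 1/N with N a positive integer, the rescaled function f_ε(x) = f(x/ε) satisfies ‖f_ε‖_{C^{-α}(T^d)} ≤ C ε^α ‖f‖_{L^∞}, where C depends only on d and α, and the C^{-α} norm is the Hölder–Besov norm defined via Littlewood–Paley blocks of the Laplacian (‖g‖_{C^{-α}} = sup_{j≥-1} 2^{-αj}‖Δ_j g‖_{L^∞}). -/
open MeasureTheory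

noncomputable section

/-- Fourier coefficient (w.r.t. frequency `k ∈ ℤ^d`) of a `1`-periodic function on `ℝ^d`,
computed over the unit cube. -/
def fourierCoeffTorus (d : ℕ) (f : (Fin d → ℝ) → ℂ) (k : Fin d → ℤ) : ℂ :=
  ∫ x in Set.Icc (0 : Fin d → ℝ) 1,
    f x * Complex.exp (-(2 * (Real.pi : ℂ) * Complex.I) * ∑ i, (k i : ℂ) * (x i : ℂ))

/-- The dyadic partition functions: `dyadicPartition ρ 0 = φ_{-1} = ρ`, and
`dyadicPartition ρ (j+1) = φ_j = φ_0 (·/2^j)` where `φ_0 = ρ(·/2) - ρ`. -/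
def dyadicPartition (ρ : ℝ → ℝ) : ℕ → ℝ → ℝ
  | 0 => ρ
  | n + 1 => fun x => ρ (x / 2 ^ (n + 1)) - ρ (x / 2 ^ n)

/-- Littlewood–Paley block `Δ_{n-1} f = φ_{n-1}(√(-Δ)) f` of a periodic function on `T^d`,
defined via Fourier multipliers (the eigenvalue of `√(-Δ)` on `e^{2πik·x}` is `2π|k|`). -/
def LPblock (d : ℕ) (ρ : ℝ → ℝ) (n : ℕ) (f : (Fin d → ℝ) → ℂ) (x : Fin d → ℝ) : ℂ :=
  ∑' k : Fin d → ℤ,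
    (dyadicPartition ρ n (2 * Real.pi * Real.sqrt (∑ i, ((k i : ℝ)) ^ 2)) : ℂ) *
      fourierCoeffTorus d f k *
      Complex.exp ((2 * (Real.pi : ℂ) * Complex.I) * ∑ i, (k i : ℂ) * (x i : ℂ))

/-- The Hölder–Besov norm `‖g‖_{C^{-α}} = sup_{j ≥ -1} 2^{-αj} ‖Δ_j g‖_{L^∞}`
(here `n = j + 1` ranges over `ℕ`). -/
def besovNegHolderNorm (d : ℕ) (ρ : ℝ → ℝ) (α : ℝ) (f : (Fin d → ℝ) → ℂ) : ℝ :=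
  ⨆ n : ℕ, (2 : ℝ) ^ (-α * ((n : ℝ) - 1)) * ⨆ x : Fin d → ℝ, ‖LPblock d ρ n f x‖

/-- projection to the torus -/
def torQ (d : ℕ) (x : Fin d → ℝ) : Fin d → UnitAddCircle := fun i => (x i : UnitAddCircle)

theorem torQ_mp (d : ℕ) : MeasurePreserving (torQ d)
    ((volume : Measure (Fin d → ℝ)).restrict (Set.Icc 0 1)) volume := by
  have h := measurePreserving_pi (ι := Fin d) (fun _ => (volume : Measure ℝ).restrict (Set.Ioc 0 (0+1)))
    (fun _ => (volume : Measure UnitAddCircle)) (fun _ => UnitAddCircle.measurePreserving_mk 0)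
  rw [← Measure.restrict_pi_pi] at h
  have e : (Measure.pi fun _ : Fin d => (volume : Measure ℝ)).restrict
      (Set.univ.pi fun _ : Fin d => Set.Ioc (0:ℝ) (0+1)) =
      (volume : Measure (Fin d → ℝ)).restrict (Set.Icc 0 1) := by
    rw [volume_pi]
    apply Measure.restrict_congr_set
    rw [zero_add]
    exact Measure.univ_pi_Ioc_ae_eq_Icc (f := (0 : Fin d → ℝ)) (g := 1)
  rw [e] at h
  exact h

theorem exists_lift {d : ℕ} {h : (Fin d → ℝ) → ℂ} (hm : Measurable h)
    (hp : ∀ (x : Fin d → ℝ) (k : Fin d → ℤ), h (x + fun i => (k i : ℝ)) = h x) :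
    ∃ G : (Fin d → UnitAddCircle) → ℂ, Measurable G ∧ ∀ x, G (torQ d x) = h x := by
  refine ⟨fun t => h (fun i => (AddCircle.measurableEquivIoc (1:ℝ) 0 (t i) : ℝ)), ?_, ?_⟩
  · apply hm.comp
    apply measurable_pi_lambda
    intro i
    exact measurable_subtype_coe.comp
      ((AddCircle.measurableEquivIoc (1:ℝ) 0).measurable.comp (measurable_pi_apply i))
  · intro x
    have : ∀ i, ∃ k : ℤ, ((AddCircle.measurableEquivIoc (1:ℝ) 0 (torQ d x i) : ℝ)) = x i + k := by
      intro i
      have h1 : ((AddCircle.measurableEquivIoc (1:ℝ) 0 (torQ d x i) : ℝ) : UnitAddCircle) = (x i : UnitAddCircle) :=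
        (AddCircle.equivIoc (1:ℝ) 0).symm_apply_apply (torQ d x i)
      rw [← sub_eq_zero, ← AddCircle.coe_sub, AddCircle.coe_eq_zero_iff] at h1
      obtain ⟨n, hn⟩ := h1
      refine ⟨n, ?_⟩
      simp only [zsmul_eq_mul, mul_one] at hn
      rw [hn]; ring
    choose k hk using this
    rw [← hp x k]
    exact congrArg h (funext hk)

theorem integral_lift {d : ℕ} {h : (Fin d → ℝ) → ℂ} {G : (Fin d → UnitAddCircle) → ℂ}
    (hG : Measurable G) (e : ∀ x, G (torQ d x) = h x) :
    ∫ x in Set.Icc (0 : Fin d → ℝ) 1, h x = ∫ t, G t := by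
  rw [← (torQ_mp d).map_eq, integral_map (torQ_mp d).measurable.aemeasurable hG.aestronglyMeasurable]
  simp [e]

theorem integral_shift {d : ℕ} {h : (Fin d → ℝ) → ℂ} (hm : Measurable h)
    (hp : ∀ (x : Fin d → ℝ) (k : Fin d → ℤ), h (x + fun i => (k i : ℝ)) = h x) (v : Fin d → ℝ) :
    ∫ x in Set.Icc (0 : Fin d → ℝ) 1, h (x + v) = ∫ x in Set.Icc (0 : Fin d → ℝ) 1, h x := by
  obtain ⟨G, hG, e⟩ := exists_lift hm hp
  rw [integral_lift hG e, integral_lift (G := fun t => G (t + torQ d v)) (hG.comp (measurable_add_const _))]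
  · exact integral_add_right_eq_self _ _
  · intro x
    rw [← e]
    rfl

theorem integral_scale {d : ℕ} {h : (Fin d → ℝ) → ℂ} (hm : Measurable h)
    (hp : ∀ (x : Fin d → ℝ) (k : Fin d → ℤ), h (x + fun i => (k i : ℝ)) = h x) (N : ℕ) (hN : 0 < N) :
    ∫ x in Set.Icc (0 : Fin d → ℝ) 1, h (fun i => (N:ℝ) * x i) = ∫ x in Set.Icc (0 : Fin d → ℝ) 1, h x := by
  obtain ⟨G, hG, e⟩ := exists_lift hm hp
  have mp := measurePreserving_pi (ι := Fin d) (fun _ => (volume : Measure UnitAddCircle))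
    (fun _ => (volume : Measure UnitAddCircle))
    (fun _ => Measure.measurePreserving_zsmul (n := (N : ℤ)) volume (by positivity))
  rw [← volume_pi] at mp
  rw [integral_lift hG e, integral_lift (G := fun t => G (fun i => (N : ℤ) • t i)) (hG.comp mp.measurable)]
  · conv_rhs => rw [← mp.map_eq]
    rw [integral_map mp.measurable.aemeasurable hG.aestronglyMeasurable]
  · intro x
    rw [← e]
    congr 1
    funext i
    simp [torQ]

theorem integral_eq_zero_of_shift {d : ℕ} {h : (Fin d → ℝ) → ℂ} (hm : Measurable h)
    (hp : ∀ (x : Fin d → ℝ) (k : Fin d → ℤ), h (x + fun i => (k i : ℝ)) = h x) (v : Fin d → ℝ)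
    (c : ℂ) (hc : c ≠ 1) (hv : ∀ x, h (x + v) = c * h x) :
    ∫ x in Set.Icc (0 : Fin d → ℝ) 1, h x = 0 := by
  have := integral_shift hm hp v
  simp_rw [hv] at this
  rw [integral_const_mul] at this
  have h2 : (c - 1) * ∫ x in Set.Icc (0 : Fin d → ℝ) 1, h x = 0 := by
    rw [sub_mul, this]; ring
  exact (mul_eq_zero.1 h2).resolve_left (sub_ne_zero.2 hc)

/-- characters -/
def chr {d : ℕ} (k : Fin d → ℤ) (x : Fin d → ℝ) : ℂ :=
  Complex.exp ((2 * (Real.pi : ℂ) * Complex.I) * ∑ i, (k i : ℂ) * (x i : ℂ))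

theorem chr_meas {d : ℕ} (k : Fin d → ℤ) : Continuous (chr k) := by
  unfold chr; fun_prop

theorem chr_norm {d : ℕ} (k : Fin d → ℤ) (x : Fin d → ℝ) : ‖chr k x‖ = 1 := by
  unfold chr
  have : (2 * (Real.pi : ℂ) * Complex.I) * ∑ i, (k i : ℂ) * (x i : ℂ)
      = ((2 * Real.pi * ∑ i, (k i : ℝ) * x i : ℝ) : ℂ) * Complex.I := by
    push_cast; ring
  rw [this, Complex.norm_exp_ofReal_mul_I]

theorem chr_add {d : ℕ} (k : Fin d → ℤ) (x y : Fin d → ℝ) : chr k (x + y) = chr k x * chr k y := by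
  unfold chr
  rw [← Complex.exp_add, ← mul_add, ← Finset.sum_add_distrib]
  simp [mul_add]

theorem chr_neg {d : ℕ} (k : Fin d → ℤ) (x : Fin d → ℝ) : chr k (-x) = chr (-k) x := by
  unfold chr; simp

theorem chr_conj {d : ℕ} (k : Fin d → ℤ) (x : Fin d → ℝ) : starRingEnd ℂ (chr k x) = chr (-k) x := by
  unfold chr; rw [← Complex.exp_conj]; simp [map_ofNat]

theorem chr_add_left {d : ℕ} (k l : Fin d → ℤ) (x : Fin d → ℝ) : chr (k + l) x = chr k x * chr l x := by
  unfold chr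
  rw [← Complex.exp_add, ← mul_add, ← Finset.sum_add_distrib]
  simp [add_mul]

theorem chr_int {d : ℕ} (k l : Fin d → ℤ) : chr k (fun i => (l i : ℝ)) = 1 := by
  unfold chr
  rw [Complex.exp_eq_one_iff]
  refine ⟨∑ i, k i * l i, ?_⟩
  push_cast; ring

theorem chr_single {d : ℕ} (k : Fin d → ℤ) (i : Fin d) (t : ℝ) :
    chr k (Pi.single i t) = Complex.exp ((2 * (Real.pi : ℂ) * Complex.I) * (k i * t)) := by
  unfold chr
  congr 2
  rw [Finset.sum_eq_single i]
  · simp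
  · intro j _ hj; simp [Pi.single_eq_of_ne hj]
  · simp

theorem chr_integral {d : ℕ} (k : Fin d → ℤ) (hk : k ≠ 0) :
    ∫ x in Set.Icc (0 : Fin d → ℝ) 1, chr k x = 0 := by
  obtain ⟨i, hi⟩ := Function.ne_iff.1 hk
  have hi' : (k i : ℂ) ≠ 0 := by simpa using hi
  apply integral_eq_zero_of_shift (chr_meas k).measurable _ (Pi.single i (1 / (2 * (k i : ℝ)))) (-1) (by norm_num)
  · intro x
    rw [chr_add, chr_single]
    have : (2 * (Real.pi : ℂ) * Complex.I) * (k i * ((1 / (2 * (k i : ℝ)) : ℝ) : ℂ)) = Real.pi * Complex.I := by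
      push_cast; field_simp
    rw [this, Complex.exp_pi_mul_I]; ring
  · intro x l
    rw [chr_add, chr_int, mul_one]

theorem fc_eq {d : ℕ} (f : (Fin d → ℝ) → ℂ) (k : Fin d → ℤ) :
    fourierCoeffTorus d f k = ∫ x in Set.Icc (0 : Fin d → ℝ) 1, f x * chr (-k) x := by
  unfold fourierCoeffTorus chr
  simp

theorem fc_scaled {d : ℕ} {f : (Fin d → ℝ) → ℂ} (hm : Measurable f)
    (hp : ∀ (x : Fin d → ℝ) (k : Fin d → ℤ), f (x + fun i => (k i : ℝ)) = f x)
    (h0 : (∫ x in Set.Icc (0 : Fin d → ℝ) 1, f x) = 0) (N : ℕ) (hN : 0 < N) (k : Fin d → ℤ)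
    (hk : ∀ i, |k i| < N) :
    fourierCoeffTorus d (fun x => f (fun i => (N : ℝ) * x i)) k = 0 := by
  rw [fc_eq]
  by_cases hk0 : k = 0
  · subst hk0
    have := integral_scale hm hp N hN
    rw [h0] at this
    simpa [chr] using this
  obtain ⟨i, hi⟩ := Function.ne_iff.1 hk0
  have hN' : (N : ℂ) ≠ 0 := by exact_mod_cast hN.ne'
  have hN'' : (N : ℝ) ≠ 0 := by exact_mod_cast hN.ne'
  refine integral_eq_zero_of_shift ?_ ?_ (Pi.single i (1 / (N:ℝ))) (chr (-k) (Pi.single i (1 / (N:ℝ)))) ?_ ?_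
  · exact (hm.comp (by fun_prop)).mul (chr_meas _).measurable
  · intro x l
    rw [chr_add, chr_int, mul_one]
    congr 1
    rw [← hp (fun i => (N : ℝ) * x i) (fun i => N * l i)]
    congr 1
    funext j
    simp [mul_add]
  · rw [chr_single, Ne, Complex.exp_eq_one_iff]
    rintro ⟨n, hn⟩
    have h2 : (2 * (Real.pi : ℂ) * Complex.I) ≠ 0 := Complex.two_pi_I_ne_zero
    rw [mul_comm (n : ℂ)] at hn
    have h3 := mul_left_cancel₀ h2 hn
    push_cast at h3
    field_simp at h3
    have h4 : - k i = N * n := by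
      have : ((- k i : ℤ) : ℂ) = ((N * n : ℤ) : ℂ) := by push_cast; simpa using h3
      exact_mod_cast this
    have h5 : (N : ℤ) ∣ k i := (dvd_neg.1 ⟨n, h4⟩)
    exact hi (Int.eq_zero_of_abs_lt_dvd h5 (hk i))
  · intro x
    rw [chr_add]
    have : f (fun j => (N:ℝ) * (x + Pi.single i (1 / (N:ℝ)) : Fin d → ℝ) j) = f (fun j => (N:ℝ) * x j) := by
      rw [← hp (fun i => (N : ℝ) * x i) (Pi.single i 1)]
      congr 1
      funext j
      by_cases hj : j = i
      · subst hj; simp [mul_add, hN'']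
      · simp [hj]
    rw [this]; ring

/-- box -/
def bx (d L : ℕ) : Finset (Fin d → ℤ) := Fintype.piFinset (fun _ => Finset.Ico 0 (L : ℤ))

theorem bx_card (d L : ℕ) : (bx d L).card = L ^ d := by
  simp [bx, Fintype.card_piFinset]

theorem integrableOn_bdd {d : ℕ} {h : (Fin d → ℝ) → ℂ} (hm : Measurable h) (M : ℝ) (hb : ∀ x, ‖h x‖ ≤ M) :
    Integrable h ((volume : Measure (Fin d → ℝ)).restrict (Set.Icc 0 1)) := by
  have : IsFiniteMeasure ((volume : Measure (Fin d → ℝ)).restrict (Set.Icc 0 1)) :=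
    ⟨by rw [Measure.restrict_apply_univ]; exact isCompact_Icc.measure_lt_top⟩
  exact Integrable.of_bound hm.aestronglyMeasurable M (Filter.Eventually.of_forall hb)

theorem sq_expand {d : ℕ} (B : Finset (Fin d → ℤ)) (z : Fin d → ℝ) :
    ∑ a ∈ B, ∑ b ∈ B, chr (a - b) z = ((‖∑ a ∈ B, chr a z‖ ^ 2 : ℝ) : ℂ) := by
  push_cast
  rw [← Complex.mul_conj', map_sum, Finset.sum_mul_sum]
  simp_rw [chr_conj, ← chr_add_left, sub_eq_add_neg]

theorem cube_vol (d : ℕ) : ∫ _x in Set.Icc (0 : Fin d → ℝ) 1, (1:ℂ) = 1 := by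
  simp [Measure.real, Real.volume_Icc_pi]

theorem fejer_int {d : ℕ} (L : ℕ) (x : Fin d → ℝ) :
    ∫ y in Set.Icc (0 : Fin d → ℝ) 1, ‖∑ a ∈ bx d L, chr a (x - y)‖ ^ 2 = (L : ℝ) ^ d := by
  have h : ((∫ y in Set.Icc (0 : Fin d → ℝ) 1, ‖∑ a ∈ bx d L, chr a (x - y)‖ ^ 2 : ℝ) : ℂ) = (L : ℂ) ^ d := by
    rw [← integral_complex_ofReal]
    simp_rw [← sq_expand, sub_eq_add_neg x, chr_add, chr_neg]
    have hi : ∀ a b : Fin d → ℤ, Integrable (fun y => chr (a - b) x * chr (-(a-b)) y)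
        ((volume : Measure (Fin d → ℝ)).restrict (Set.Icc 0 1)) := fun a b =>
      integrableOn_bdd (by have := (chr_meas (-(a-b))).measurable; fun_prop) 1 (by simp [chr_norm])
    rw [integral_finsetSum _ (fun a _ => integrable_finsetSum _ (fun b _ => hi a b))]
    have : ∀ a ∈ bx d L, ∫ y in Set.Icc (0 : Fin d → ℝ) 1, ∑ b ∈ bx d L, chr (a - b) x * chr (-(a-b)) y = 1 := by
      intro a ha
      rw [integral_finsetSum _ (fun b _ => hi a b), Finset.sum_eq_single a]
      · simp only [sub_self, chr]
        simpa using cube_vol d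
      · intro b _ hb
        rw [integral_const_mul, chr_integral, mul_zero]
        rw [neg_ne_zero, sub_ne_zero]; exact hb.symm
      · exact fun h => absurd ha h
    rw [Finset.sum_congr rfl this]
    simp [bx_card]
  exact_mod_cast h

theorem fejer_bound {d : ℕ} (L : ℕ) {g : (Fin d → ℝ) → ℂ} (hm : Measurable g) (M : ℝ)
    (hb : ∀ x, ‖g x‖ ≤ M) (x : Fin d → ℝ) :
    ‖∑ a ∈ bx d L, ∑ b ∈ bx d L, fourierCoeffTorus d g (a - b) * chr (a - b) x‖ ≤ M * (L : ℝ) ^ d := by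
  have hi : ∀ a b : Fin d → ℤ, Integrable (fun y => g y * chr (-(a-b)) y * chr (a - b) x)
        ((volume : Measure (Fin d → ℝ)).restrict (Set.Icc 0 1)) := fun a b =>
      integrableOn_bdd (by have := (chr_meas (-(a-b))).measurable; fun_prop) M (by simp [chr_norm, hb])
  have : ∑ a ∈ bx d L, ∑ b ∈ bx d L, fourierCoeffTorus d g (a - b) * chr (a - b) x
      = ∫ y in Set.Icc (0 : Fin d → ℝ) 1, g y * ((‖∑ a ∈ bx d L, chr a (x - y)‖ ^ 2 : ℝ) : ℂ) := by
    simp_rw [← sq_expand, sub_eq_add_neg x, chr_add, chr_neg, Finset.mul_sum, fc_eq, ← integral_mul_const]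
    rw [← Finset.sum_congr rfl (fun a _ => integral_finsetSum _ (fun b _ => hi a b)),
      ← integral_finsetSum _ (fun a _ => integrable_finsetSum _ (fun b _ => hi a b))]
    congr 1
    funext y
    refine Finset.sum_congr rfl fun a _ => Finset.sum_congr rfl fun b _ => by ring
  rw [this, ← fejer_int L x, ← integral_const_mul]
  apply norm_integral_le_of_norm_le
  · apply Integrable.const_mul
    have c : Continuous fun y : Fin d → ℝ => ‖∑ a ∈ bx d L, chr a (x - y)‖ ^ 2 := by
      have := fun a : Fin d → ℤ => chr_meas a
      fun_prop
    exact c.continuousOn.integrableOn_compact isCompact_Icc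
  · refine Filter.Eventually.of_forall fun y => ?_
    rw [norm_mul, Complex.norm_real, Real.norm_of_nonneg (by positivity)]
    exact mul_le_mul_of_nonneg_right (hb y) (by positivity)

theorem mult_bound {d : ℕ} (L : ℕ) {g : (Fin d → ℝ) → ℂ} (hm : Measurable g) (M : ℝ)
    (hb : ∀ x, ‖g x‖ ≤ M) (x : Fin d → ℝ) {F : EuclideanSpace ℝ (Fin d) → ℂ} (hF : Integrable F)
    (R : ℝ) (φ : (Fin d → ℤ) → ℂ)
    (hφ : ∀ k, φ k = ∫ v, chr k (fun i => v i / R) * F v) :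
    ‖∑ a ∈ bx d L, ∑ b ∈ bx d L, φ (a - b) * fourierCoeffTorus d g (a - b) * chr (a - b) x‖
      ≤ M * (L : ℝ) ^ d * ∫ v, ‖F v‖ := by
  have hi0 : ∀ k : Fin d → ℤ, Integrable (fun v : EuclideanSpace ℝ (Fin d) => chr k (fun i => v i / R) * F v) := by
    intro k
    apply hF.bdd_mul (c := 1)
    · have : Continuous fun v : EuclideanSpace ℝ (Fin d) => chr k (fun i => v i / R) := by
        have := chr_meas k
        fun_prop
      exact this.aestronglyMeasurable
    · simp [chr_norm]
  have hi : ∀ a b : Fin d → ℤ, Integrable (fun v : EuclideanSpace ℝ (Fin d) =>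
      chr (a - b) (fun i => v i / R) * F v * (fourierCoeffTorus d g (a - b) * chr (a - b) x)) := fun a b => (hi0 _).mul_const _
  have : ∑ a ∈ bx d L, ∑ b ∈ bx d L, φ (a - b) * fourierCoeffTorus d g (a - b) * chr (a - b) x
    = ∫ v, F v * ∑ a ∈ bx d L, ∑ b ∈ bx d L, fourierCoeffTorus d g (a - b) * chr (a - b) (x + fun i => v i / R) := by
    simp_rw [mul_assoc, hφ, ← integral_mul_const]
    rw [← Finset.sum_congr rfl (fun a _ => integral_finsetSum _ (fun b _ => hi a b)),
      ← integral_finsetSum _ (fun a _ => integrable_finsetSum _ (fun b _ => hi a b))]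
    congr 1
    funext y
    simp_rw [Finset.mul_sum, chr_add]
    refine Finset.sum_congr rfl fun a _ => Finset.sum_congr rfl fun b _ => by ring
  rw [this, ← integral_const_mul]
  apply norm_integral_le_of_norm_le
  · exact hF.norm.const_mul _
  · refine Filter.Eventually.of_forall fun v => ?_
    rw [norm_mul, mul_comm]
    exact mul_le_mul_of_nonneg_right (fejer_bound L hm M hb _) (by positivity)

theorem count_tendsto {d : ℕ} (k : Fin d → ℤ) :
    Filter.Tendsto (fun L : ℕ => (((bx d L).filter (fun b => b + k ∈ bx d L)).card : ℝ) / (L : ℝ) ^ d)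
      Filter.atTop (nhds 1) := by
  have h1 : ∀ L, (bx d L).filter (fun b => b + k ∈ bx d L) =
      Fintype.piFinset (fun i => Finset.Ico (max 0 (- k i)) (min (L : ℤ) (L - k i))) := by
    intro L
    ext b
    simp only [bx, Finset.mem_filter, Fintype.mem_piFinset, Finset.mem_Ico, Pi.add_apply, ← forall_and]
    refine forall_congr' fun i => ?_
    omega
  have h2 : Filter.Tendsto (fun L : ℕ => ∏ i, (1 - (|k i| : ℝ) / (L : ℝ))) Filter.atTop (nhds 1) := by
    have h := tendsto_finsetProd (f := fun (i : Fin d) (L : ℕ) => (1 - (|k i| : ℝ) / (L : ℝ)))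
      (a := fun _ => (1 - 0 : ℝ)) (x := Filter.atTop) Finset.univ (fun i _ =>
      tendsto_const_nhds.sub (tendsto_const_div_atTop_nhds_zero_nat _))
    simpa using h
  refine h2.congr' ?_
  filter_upwards [Filter.eventually_ge_atTop (1 + ∑ i, (k i).natAbs)] with L hL
  have hL0 : (L : ℝ) ≠ 0 := by
    have : 0 < L := by omega
    positivity
  rw [h1, Fintype.card_piFinset]
  push_cast
  have : (L:ℝ)^d = ∏ i : Fin d, (L : ℝ) := by simp
  rw [this, ← Finset.prod_div_distrib]
  refine Finset.prod_congr rfl fun i _ => ?_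
  have hi : (k i).natAbs ≤ ∑ i, (k i).natAbs := Finset.single_le_sum (f := fun i => (k i).natAbs) (fun _ _ => Nat.zero_le _) (Finset.mem_univ i)
  rw [Int.card_Ico]
  have : (((min (L : ℤ) (L - k i) - max 0 (- k i)).toNat : ℕ) : ℤ) = L - |k i| := by
    rw [Int.abs_eq_natAbs]
    omega
  have h3 : (((min (L : ℤ) (L - k i) - max 0 (- k i)).toNat : ℕ) : ℝ) = L - |(k i : ℝ)| := by
    have := congrArg (Int.cast (R := ℝ)) this
    push_cast at this
    simpa using this
  rw [h3]
  field_simp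

theorem sum_tendsto {d : ℕ} (c : (Fin d → ℤ) → ℂ) (T : Finset (Fin d → ℤ)) (hT : ∀ k ∉ T, c k = 0) :
    Filter.Tendsto (fun L : ℕ => (∑ a ∈ bx d L, ∑ b ∈ bx d L, c (a - b)) / (L : ℂ) ^ d) Filter.atTop
      (nhds (∑' k, c k)) := by
  rw [tsum_eq_sum (s := T) hT]
  have h : ∀ L : ℕ, (∑ a ∈ bx d L, ∑ b ∈ bx d L, c (a - b)) / (L : ℂ) ^ d =
      ∑ k ∈ T, (((((bx d L).filter (fun b => b + k ∈ bx d L)).card : ℝ) / (L : ℝ) ^ d : ℝ) : ℂ) * c k := by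
    intro L
    rw [Finset.sum_comm]
    have : ∀ b ∈ bx d L, ∑ a ∈ bx d L, c (a - b) = ∑ k ∈ T, if b + k ∈ bx d L then c k else 0 := by
      intro b _
      rw [← Finset.sum_filter]
      refine Finset.sum_bij_ne_zero (fun a _ _ => a - b) ?_ ?_ ?_ ?_
      · intro a ha hne
        simp only [Finset.mem_filter, add_sub_cancel]
        exact ⟨by by_contra h; exact hne (hT _ h), ha⟩
      · intro a _ _ a' _ _ h
        simpa using h
      · intro k hk hne
        refine ⟨b + k, (Finset.mem_filter.1 hk).2, by simpa using hne, by simp⟩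
      · intros; rfl
    rw [Finset.sum_congr rfl this, Finset.sum_comm, Finset.sum_div]
    refine Finset.sum_congr rfl fun k _ => ?_
    rw [← Finset.sum_filter, Finset.sum_const, nsmul_eq_mul]
    push_cast; ring
  simp_rw [h]
  refine tendsto_finsetSum _ fun k _ => ?_
  have := ((Complex.continuous_ofReal.tendsto _).comp (count_tendsto k)).mul_const (c k)
  simpa using this

theorem tsum_bound {d : ℕ} {g : (Fin d → ℝ) → ℂ} (hm : Measurable g) (M : ℝ)
    (hb : ∀ x, ‖g x‖ ≤ M) (x : Fin d → ℝ) {F : EuclideanSpace ℝ (Fin d) → ℂ} (hF : Integrable F)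
    (R : ℝ) (φ : (Fin d → ℤ) → ℂ)
    (hφ : ∀ k, φ k = ∫ v, chr k (fun i => v i / R) * F v) (T : Finset (Fin d → ℤ)) (hT : ∀ k ∉ T, φ k = 0) :
    ‖∑' k, φ k * fourierCoeffTorus d g k * chr k x‖ ≤ M * ∫ v, ‖F v‖ := by
  refine le_of_tendsto (sum_tendsto (fun k => φ k * fourierCoeffTorus d g k * chr k x) T
    (fun k hk => by simp [hT k hk])).norm ?_
  filter_upwards [Filter.eventually_ge_atTop 1] with L hL
  have : 0 < (L:ℝ) ^ d := by positivity
  rw [norm_div, norm_pow, Complex.norm_natCast, div_le_iff₀ this]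
  refine (mult_bound L hm M hb x hF R φ hφ).trans (le_of_eq (by ring))

theorem exists_kernel (d : ℕ) (ρ : ℝ → ℝ) (hρ_smooth : ContDiff ℝ (⊤ : ℕ∞) ρ)
    (hρ_supp : Function.support ρ ⊆ Set.Ioo (-1 : ℝ) 1)
    (hρ_one : ∀ x ∈ Set.Icc (-(3/4) : ℝ) (3/4), ρ x = 1) :
    ∃ F : EuclideanSpace ℝ (Fin d) → ℂ, Integrable F ∧ ∀ (R : ℝ), 0 < R → ∀ k : Fin d → ℤ,
      ((ρ (2 * Real.pi * Real.sqrt (∑ i, ((k i : ℝ)) ^ 2) / R) : ℝ) : ℂ) =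
        ∫ v, chr k (fun i => v i / R) * F v := by
  have hpi := Real.pi_pos
  let φ : EuclideanSpace ℝ (Fin d) → ℂ := fun ξ => ((ρ (2 * Real.pi * ‖ξ‖) : ℝ) : ℂ)
  have hs : ContDiff ℝ (⊤ : ℕ∞) φ := by
    refine Complex.ofRealCLM.contDiff.comp ?_
    rw [contDiff_iff_contDiffAt]
    intro ξ
    by_cases h : ξ = 0
    · subst h
      have : (fun ξ : EuclideanSpace ℝ (Fin d) => ρ (2 * Real.pi * ‖ξ‖)) =ᶠ[nhds 0] fun _ => 1 := by
        have hc : Continuous fun ξ : EuclideanSpace ℝ (Fin d) => 2 * Real.pi * ‖ξ‖ := by fun_prop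
        have h1 : ∀ᶠ ξ in nhds (0 : EuclideanSpace ℝ (Fin d)), 2 * Real.pi * ‖ξ‖ < 3/4 := by
          apply hc.continuousAt.eventually_lt continuousAt_const
          simp
        filter_upwards [h1] with ξ hξ
        apply hρ_one
        constructor
        · have : 0 ≤ 2 * Real.pi * ‖ξ‖ := by positivity
          linarith
        · exact hξ.le
      exact contDiffAt_const.congr_of_eventuallyEq this
    · exact hρ_smooth.contDiffAt.comp ξ (contDiffAt_const.mul (contDiffAt_norm ℝ h))
  have hc : HasCompactSupport φ := by
    refine HasCompactSupport.of_support_subset_isCompact (isCompact_closedBall (0 : EuclideanSpace ℝ (Fin d)) 1) ?_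
    intro ξ hξ
    have h1 : ρ (2 * Real.pi * ‖ξ‖) ≠ 0 := by simpa [φ] using hξ
    have h2 := (hρ_supp h1).2
    have h3 := Real.pi_gt_three
    have h4 := norm_nonneg ξ
    rw [mem_closedBall_zero_iff]
    nlinarith
  let φS := hc.toSchwartzMap hs
  have hφS : (φS : EuclideanSpace ℝ (Fin d) → ℂ) = φ := rfl
  have hFi : Integrable (FourierTransform.fourier φ) := by
    rw [← hφS, ← SchwartzMap.fourier_coe]
    exact (FourierTransform.fourier φS).integrable
  refine ⟨FourierTransform.fourier φ, hFi, ?_⟩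
  intro R hR k
  have hinv := Continuous.fourierInv_fourier_eq hs.continuous (by rw [← hφS]; exact φS.integrable) hFi
  have h := congrFun hinv (WithLp.toLp 2 (fun i => (k i : ℝ) / R))
  rw [Real.fourierInv_eq'] at h
  have e : φ (WithLp.toLp 2 (fun i => (k i : ℝ) / R)) =
      ((ρ (2 * Real.pi * Real.sqrt (∑ i, ((k i : ℝ)) ^ 2) / R) : ℝ) : ℂ) := by
    simp only [φ]
    congr 2
    rw [EuclideanSpace.norm_eq]
    simp only [Real.norm_eq_abs, sq_abs, div_pow]
    rw [← Finset.sum_div, Real.sqrt_div' _ (by positivity), Real.sqrt_sq hR.le]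
    ring
  rw [← e, ← h]
  congr 1
  funext v
  rw [smul_eq_mul]
  congr 1
  unfold chr
  congr 1
  rw [PiLp.inner_apply]
  simp only [RCLike.inner_apply, conj_trivial]
  push_cast
  rw [mul_right_comm]
  congr 1
  refine Finset.sum_congr rfl fun i _ => ?_
  push_cast; ring

theorem abs_le_sqrt_sum {d : ℕ} (k : Fin d → ℤ) (i : Fin d) :
    |(k i : ℝ)| ≤ Real.sqrt (∑ i, ((k i : ℝ)) ^ 2) := by
  apply Real.abs_le_sqrt
  exact Finset.single_le_sum (f := fun i => (k i : ℝ) ^ 2) (fun _ _ => sq_nonneg _) (Finset.mem_univ i)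

theorem exists_fin {d : ℕ} (ρ : ℝ → ℝ)
    (hρ_supp : Function.support ρ ⊆ Set.Ioo (-1 : ℝ) 1) (R : ℝ) (hR : 0 < R) :
    ∃ T : Finset (Fin d → ℤ), ∀ k ∉ T,
      ((ρ (2 * Real.pi * Real.sqrt (∑ i, ((k i : ℝ)) ^ 2) / R) : ℝ) : ℂ) = 0 := by
  refine ⟨Finset.Icc (fun _ => -⌈R⌉) (fun _ => ⌈R⌉), fun k hk => ?_⟩
  by_contra h
  have h1 : ρ (2 * Real.pi * Real.sqrt (∑ i, ((k i : ℝ)) ^ 2) / R) ≠ 0 := by simpa using h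
  have h2 := (hρ_supp h1).2
  rw [div_lt_one hR] at h2
  have h3 := Real.pi_gt_three
  have h4 := Real.sqrt_nonneg (∑ i, ((k i : ℝ)) ^ 2)
  apply hk
  have key : ∀ i, |(k i : ℝ)| ≤ (⌈R⌉ : ℝ) := fun i => by
    have := abs_le_sqrt_sum k i
    have := Int.le_ceil R
    nlinarith
  rw [Finset.mem_Icc]
  constructor
  · intro i
    have := (abs_le.1 (key i)).1
    exact_mod_cast this
  · intro i
    have := (abs_le.1 (key i)).2
    exact_mod_cast this

theorem dy_zero (ρ : ℝ → ℝ) (hρ_supp : Function.support ρ ⊆ Set.Ioo (-1 : ℝ) 1) (n : ℕ) (t : ℝ)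
    (ht : (2:ℝ) ^ n ≤ t) : dyadicPartition ρ n t = 0 := by
  have hz : ∀ s, 1 ≤ s → ρ s = 0 := fun s hs => by
    by_contra h
    exact absurd (hρ_supp h).2 (not_lt.2 hs)
  cases n with
  | zero => exact hz t (by simpa using ht)
  | succ n =>
    simp only [dyadicPartition]
    rw [hz, hz, sub_zero]
    · rw [le_div_iff₀ (by positivity), one_mul]
      refine le_trans ?_ ht
      gcongr <;> norm_num
    · rw [le_div_iff₀ (by positivity), one_mul]; exact ht

theorem LP_bound {d : ℕ} (ρ : ℝ → ℝ) (hρ_supp : Function.support ρ ⊆ Set.Ioo (-1 : ℝ) 1)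
    {F : EuclideanSpace ℝ (Fin d) → ℂ} (hF : Integrable F)
    (hFρ : ∀ (R : ℝ), 0 < R → ∀ k : Fin d → ℤ,
      ((ρ (2 * Real.pi * Real.sqrt (∑ i, ((k i : ℝ)) ^ 2) / R) : ℝ) : ℂ) =
        ∫ v, chr k (fun i => v i / R) * F v)
    {g : (Fin d → ℝ) → ℂ} (hm : Measurable g) (M : ℝ)
    (hb : ∀ x, ‖g x‖ ≤ M) (x : Fin d → ℝ) (n : ℕ) :
    ‖LPblock d ρ n g x‖ ≤ 2 * (M * ∫ v, ‖F v‖) := by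
  have key : ∀ R : ℝ, 0 < R → ‖∑' k : Fin d → ℤ, ((ρ (2 * Real.pi * Real.sqrt (∑ i, ((k i : ℝ)) ^ 2) / R) : ℝ) : ℂ)
      * fourierCoeffTorus d g k * chr k x‖ ≤ M * ∫ v, ‖F v‖ := by
    intro R hR
    obtain ⟨T, hT⟩ := exists_fin (d := d) ρ hρ_supp R hR
    exact tsum_bound hm M hb x hF R _ (hFρ R hR) T hT
  have hsum : ∀ R : ℝ, 0 < R → Summable fun k : Fin d → ℤ => ((ρ (2 * Real.pi * Real.sqrt (∑ i, ((k i : ℝ)) ^ 2) / R) : ℝ) : ℂ)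
      * fourierCoeffTorus d g k * chr k x := by
    intro R hR
    obtain ⟨T, hT⟩ := exists_fin (d := d) ρ hρ_supp R hR
    exact summable_of_ne_finset_zero (s := T) (fun k hk => by simp [hT k hk])
  have hpos : 0 ≤ M * ∫ v, ‖F v‖ := (norm_nonneg _).trans (key 1 one_pos)
  cases n with
  | zero =>
    have h := key 1 one_pos
    simp only [div_one] at h
    simp only [LPblock, dyadicPartition]
    change ‖∑' k : Fin d → ℤ, ((ρ (2 * Real.pi * Real.sqrt (∑ i, ((k i : ℝ)) ^ 2)) : ℝ) : ℂ)
      * fourierCoeffTorus d g k * chr k x‖ ≤ _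
    linarith
  | succ n =>
    have p1 : (0:ℝ) < 2 ^ (n+1) := by positivity
    have p2 : (0:ℝ) < 2 ^ n := by positivity
    have e : LPblock d ρ (n+1) g x = (∑' k : Fin d → ℤ, ((ρ (2 * Real.pi * Real.sqrt (∑ i, ((k i : ℝ)) ^ 2) / 2 ^ (n+1)) : ℝ) : ℂ)
      * fourierCoeffTorus d g k * chr k x) - ∑' k : Fin d → ℤ, ((ρ (2 * Real.pi * Real.sqrt (∑ i, ((k i : ℝ)) ^ 2) / 2 ^ n) : ℝ) : ℂ)
      * fourierCoeffTorus d g k * chr k x := by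
      rw [← (hsum _ p1).tsum_sub (hsum _ p2)]
      simp only [LPblock, dyadicPartition]
      congr 1
      funext k
      simp only [chr]
      push_cast
      ring
    rw [e]
    refine (norm_sub_le _ _).trans ?_
    linarith [key _ p1, key _ p2]

/-- If `f` is bounded, measurable, `1`-periodic and has mean zero on `T^d`, then the
oscillatory rescaling `f_ε = f(·/ε)`, `ε = 1/N`, satisfies
`‖f_ε‖_{C^{-α}} ≤ C ε^α ‖f‖_{L^∞}`. -/
theorem statement0 (d : ℕ) (hd : 0 < d) (α : ℝ) (hα : 0 < α)
    (ρ : ℝ → ℝ) (hρ_smooth : ContDiff ℝ (⊤ : ℕ∞) ρ) (hρ_even : ∀ x, ρ (-x) = ρ x)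
    (hρ_supp : Function.support ρ ⊆ Set.Ioo (-1 : ℝ) 1)
    (hρ_one : ∀ x ∈ Set.Icc (-(3/4) : ℝ) (3/4), ρ x = 1)
    (hρ_range : ∀ x, ρ x ∈ Set.Icc (0 : ℝ) 1) :
    ∃ C > 0, ∀ (f : (Fin d → ℝ) → ℂ) (M : ℝ), Measurable f →
      (∀ (x : Fin d → ℝ) (k : Fin d → ℤ), f (x + fun i => (k i : ℝ)) = f x) →
      (∀ x, ‖f x‖ ≤ M) →
      (∫ x in Set.Icc (0 : Fin d → ℝ) 1, f x) = 0 →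
      ∀ N : ℕ, 0 < N →
        besovNegHolderNorm d ρ α (fun x => f (fun i => (N : ℝ) * x i)) ≤
          C * ((N : ℝ)⁻¹) ^ α * M := by
  obtain ⟨F, hF, hFρ⟩ := exists_kernel d ρ hρ_smooth hρ_supp hρ_one
  have hI : 0 ≤ ∫ v, ‖F v‖ := integral_nonneg fun _ => norm_nonneg _
  refine ⟨(2:ℝ) ^ α * (2 * (∫ v, ‖F v‖)) + 1, by positivity, ?_⟩
  intro f M hm hp hb h0 N hN
  have hM : 0 ≤ M := (norm_nonneg _).trans (hb 0)
  have hNpos : (0:ℝ) < N := by exact_mod_cast hN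
  have hNα : 0 ≤ ((N : ℝ)⁻¹) ^ α := by positivity
  have hgm : Measurable (fun x : Fin d → ℝ => f (fun i => (N : ℝ) * x i)) := hm.comp (by fun_prop)
  have hRHS : 0 ≤ ((2:ℝ) ^ α * (2 * (∫ v, ‖F v‖)) + 1) * ((N : ℝ)⁻¹) ^ α * M := by positivity
  unfold besovNegHolderNorm
  refine Real.iSup_le (fun n => ?_) hRHS
  by_cases hn : (2:ℝ) ^ n ≤ N
  · have hz : ∀ x, LPblock d ρ n (fun x => f (fun i => (N : ℝ) * x i)) x = 0 := by
      intro x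
      unfold LPblock
      rw [← tsum_zero (β := Fin d → ℤ)]
      congr 1
      funext k
      by_cases hk : ∀ i, |k i| < N
      · rw [fc_scaled hm hp h0 N hN k hk]; simp
      · push Not at hk
        obtain ⟨i, hi⟩ := hk
        have hi' : (N : ℝ) ≤ |(k i : ℝ)| := by exact_mod_cast hi
        have h1 := abs_le_sqrt_sum k i
        have h3 := Real.pi_gt_three
        have h4 := Real.sqrt_nonneg (∑ i, ((k i : ℝ)) ^ 2)
        rw [dy_zero ρ hρ_supp n _ (by nlinarith)]
        simp
    simp only [hz, norm_zero, Real.iSup_const_zero, mul_zero]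
    exact hRHS
  · push Not at hn
    have hs : ⨆ x : Fin d → ℝ, ‖LPblock d ρ n (fun x => f (fun i => (N : ℝ) * x i)) x‖
        ≤ 2 * (M * ∫ v, ‖F v‖) :=
      Real.iSup_le (fun x => LP_bound ρ hρ_supp hF hFρ hgm M (fun x => hb _) x n) (by positivity)
    have h2 : (2 : ℝ) ^ (-α * ((n : ℝ) - 1)) ≤ (2:ℝ) ^ α * ((N : ℝ)⁻¹) ^ α := by
      have : (2 : ℝ) ^ (-α * ((n : ℝ) - 1)) = (2:ℝ) ^ α * (((2:ℝ) ^ n)⁻¹) ^ α := by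
        rw [← Real.rpow_natCast, ← Real.rpow_neg (by norm_num), ← Real.rpow_mul (by norm_num),
          ← Real.rpow_add (by norm_num)]
        congr 1; ring
      rw [this]
      gcongr
    calc _ ≤ ((2:ℝ) ^ α * ((N : ℝ)⁻¹) ^ α) * (2 * (M * ∫ v, ‖F v‖)) :=
          mul_le_mul h2 hs (Real.iSup_nonneg fun _ => norm_nonneg _) (by positivity)
      _ = ((2:ℝ) ^ α * (2 * (∫ v, ‖F v‖))) * ((N : ℝ)⁻¹) ^ α * M := by ring
      _ ≤ _ := by
          gcongr
          linarith
end
end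

section
/- Let d ≥ 1, α ∈ (0, d), and λ > 0. There is a constant C depending only on d, α, λ such that for all n ∈ Z and all distinct x, z ∈ T^d: ∫_{T^d} 2^{dn} |y-z|^{-α} (1 + 2^n |x-y|)^{-(d+λ)} dy ≤ C |z-x|^{-α}, where distances on the torus are the geodesic distances. -/
open MeasureTheory

noncomputable section

/-- Geodesic distance on the unit torus `T^d = (ℝ/ℤ)^d`, for points represented in `ℝ^d`:
the infimum of the Euclidean distances over all integer translates. -/
def torusDist (d : ℕ) (x y : Fin d → ℝ) : ℝ :=
  ⨅ k : Fin d → ℤ, Real.sqrt (∑ i, (x i - y i - (k i : ℝ)) ^ 2)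

lemma td_bdd (d : ℕ) (x y : Fin d → ℝ) :
    BddBelow (Set.range fun k : Fin d → ℤ => Real.sqrt (∑ i, (x i - y i - (k i : ℝ)) ^ 2)) :=
  ⟨0, by rintro _ ⟨k, rfl⟩; exact Real.sqrt_nonneg _⟩

lemma td_nonneg (d : ℕ) (x y : Fin d → ℝ) : 0 ≤ torusDist d x y :=
  Real.iInf_nonneg fun _ => Real.sqrt_nonneg _

lemma td_le (d : ℕ) (x y : Fin d → ℝ) (k : Fin d → ℤ) :
    torusDist d x y ≤ Real.sqrt (∑ i, (x i - y i - (k i : ℝ)) ^ 2) :=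
  ciInf_le (td_bdd d x y) k

lemma td_symm_le (d : ℕ) (x y : Fin d → ℝ) : torusDist d x y ≤ torusDist d y x := by
  refine le_ciInf fun k => (td_le d x y (fun i => -k i)).trans (le_of_eq ?_)
  congr 1
  refine Finset.sum_congr rfl fun i _ => ?_
  push_cast
  ring

lemma td_symm (d : ℕ) (x y : Fin d → ℝ) : torusDist d x y = torusDist d y x :=
  le_antisymm (td_symm_le d x y) (td_symm_le d y x)

lemma sqrt_tri (d : ℕ) (a b : Fin d → ℝ) :
    Real.sqrt (∑ i, (a i + b i) ^ 2) ≤ Real.sqrt (∑ i, a i ^ 2) + Real.sqrt (∑ i, b i ^ 2) := by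
  have := norm_add_le (WithLp.toLp 2 a : EuclideanSpace ℝ (Fin d)) (WithLp.toLp 2 b)
  simpa [EuclideanSpace.norm_eq] using this

lemma td_tri (d : ℕ) (x y z : Fin d → ℝ) :
    torusDist d x z ≤ torusDist d x y + torusDist d y z := by
  have h : ∀ k l : Fin d → ℤ, torusDist d x z ≤ Real.sqrt (∑ i, (x i - y i - (k i : ℝ)) ^ 2)
      + Real.sqrt (∑ i, (y i - z i - (l i : ℝ)) ^ 2) := by
    intro k l
    refine (td_le d x z (fun i => k i + l i)).trans ?_
    refine le_trans (le_of_eq ?_) (sqrt_tri d _ _)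
    congr 1
    refine Finset.sum_congr rfl fun i _ => ?_
    push_cast
    ring
  exact le_ciInf_add_ciInf h

/-- The representative of `y - z` closest to the origin. -/
def rep (d : ℕ) (y z : Fin d → ℝ) : Fin d → ℝ := fun i => y i - z i - (round (y i - z i) : ℝ)

lemma rep_le (d : ℕ) (y z : Fin d → ℝ) : ‖rep d y z‖ ≤ torusDist d y z := by
  refine le_ciInf fun k => ?_
  refine (pi_norm_le_iff_of_nonneg (Real.sqrt_nonneg _)).2 fun i => ?_
  refine (round_le (y i - z i) (k i)).trans ?_
  refine Real.abs_le_sqrt ?_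
  exact Finset.single_le_sum (f := fun i => (y i - z i - (k i : ℝ)) ^ 2)
    (fun _ _ => sq_nonneg _) (Finset.mem_univ i)

lemma rep_zero (d : ℕ) (y z : Fin d → ℝ) (h : rep d y z = 0) : torusDist d y z = 0 := by
  refine le_antisymm ?_ (td_nonneg _ _ _)
  refine (td_le d y z (fun i => round (y i - z i))).trans (le_of_eq ?_)
  have h' : ∀ i, y i - z i - (round (y i - z i) : ℝ) = 0 := fun i => congrFun h i
  simp [h']

/-- periodization -/
def per (d : ℕ) (h : (Fin d → ℝ) → ENNReal) (z y : Fin d → ℝ) : ENNReal :=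
  ∑' k : Fin d → ℤ, h (y - (z + fun i => (k i : ℝ)))

lemma le_per (d : ℕ) (h : (Fin d → ℝ) → ENNReal) (z y : Fin d → ℝ) :
    h (rep d y z) ≤ per d h z y := by
  have := ENNReal.le_tsum (f := fun k : Fin d → ℤ => h (y - (z + fun i => (k i : ℝ))))
    (fun i => round (y i - z i))
  refine le_trans (le_of_eq ?_) this
  congr 1
  ext i
  simp [rep]
  ring

lemma per_meas (d : ℕ) (h : (Fin d → ℝ) → ENNReal) (hm : Measurable h) (z : Fin d → ℝ) :
    Measurable (per d h z) := by
  unfold per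
  refine Measurable.ennreal_tsum fun k => ?_
  exact hm.comp (measurable_id.sub_const _)

lemma per_int (d : ℕ) (h : (Fin d → ℝ) → ENNReal) (hm : Measurable h) (z : Fin d → ℝ) :
    ∫⁻ y in Set.Ico (0 : Fin d → ℝ) 1, per d h z y ≤ ∫⁻ w, h w := by
  set I : Set (Fin d → ℝ) := Set.univ.pi fun _ => Set.Ico (0 : ℝ) 1 with hIdef
  have hI : MeasurableSet I := MeasurableSet.univ_pi fun _ => measurableSet_Ico
  have hae : I =ᵐ[volume] Set.Icc (0 : Fin d → ℝ) 1 :=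
    Measure.univ_pi_Ico_ae_eq_Icc (μ := fun _ : Fin d => (volume : Measure ℝ))
      (f := (0 : Fin d → ℝ)) (g := 1)
  refine (lintegral_mono_set Set.Ico_subset_Icc_self).trans ?_
  rw [← Measure.restrict_congr_set hae]
  unfold per
  rw [lintegral_tsum fun k => Measurable.aemeasurable (by fun_prop)]
  have e : ∀ k : Fin d → ℤ, ∫⁻ y in I, h (y - (z + fun i => (k i : ℝ)))
      = ∫⁻ w in (fun w => w + (z + fun i => (k i : ℝ))) ⁻¹' I, h w := by
    intro k
    rw [← lintegral_indicator hI, ← lintegral_indicator (hI.preimage (measurable_add_const _)),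
      ← lintegral_add_right_eq_self _ (z + fun i => (k i : ℝ))]
    congr 1
    ext w
    simp [Set.indicator]
    rfl
  simp_rw [e]
  rw [← lintegral_iUnion (fun k => hI.preimage (measurable_add_const _))]
  · exact setLIntegral_le_lintegral _ _
  · intro k l hkl
    rw [Function.onFun, Set.disjoint_left]
    intro w hk hl
    apply hkl
    ext i
    have a := hk i (Set.mem_univ i)
    have b := hl i (Set.mem_univ i)
    simp at a b
    have h1 : (k i : ℝ) < l i + 1 := by linarith
    have h2 : (l i : ℝ) < k i + 1 := by linarith
    have h1' : k i < l i + 1 := by exact_mod_cast h1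
    have h2' : l i < k i + 1 := by exact_mod_cast h2
    omega

lemma intA (d : ℕ) (lam : ℝ) (hlam : 0 < lam) (R : ℝ) (hR : 0 < R) :
    ∫⁻ w : Fin d → ℝ, ENNReal.ofReal (R ^ d * (1 + R * ‖w‖) ^ (-((d : ℝ) + lam)))
      = ENNReal.ofReal (∫ w : Fin d → ℝ, (1 + ‖w‖) ^ (-((d : ℝ) + lam))) := by
  have hi : Integrable (fun w : Fin d → ℝ => (1 + ‖w‖) ^ (-((d : ℝ) + lam))) :=
    integrable_one_add_norm (by simp [hlam])
  have hi2 : Integrable (fun w : Fin d → ℝ => R ^ d * (1 + R * ‖w‖) ^ (-((d : ℝ) + lam))) := by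
    have := (hi.comp_smul hR.ne').const_mul (R ^ d)
    simpa [norm_smul, abs_of_pos hR] using this
  rw [← ofReal_integral_eq_lintegral_ofReal hi2 (Filter.Eventually.of_forall fun w => by positivity)]
  congr 1
  rw [integral_const_mul]
  have := Measure.integral_comp_smul_of_nonneg (volume : Measure (Fin d → ℝ))
    (fun w : Fin d → ℝ => (1 + ‖w‖) ^ (-((d : ℝ) + lam))) R (hR := hR.le)
  simp only [norm_smul, Real.norm_eq_abs, abs_of_pos hR, Module.finrank_fin_fun, smul_eq_mul] at this
  rw [this]
  field_simp

lemma intB (d : ℕ) (hd : 0 < d) (α : ℝ) (hαd : α < d) (r : ℝ) (hr : 0 < r) :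
    ∫⁻ w : Fin d → ℝ, ENNReal.ofReal ((Set.Iio r).indicator (fun t : ℝ => t ^ (-α)) ‖w‖)
      = ENNReal.ofReal (d * volume.real (Metric.ball (0 : Fin d → ℝ) 1) * (r ^ (d - α) / (d - α))) := by
  haveI : Nonempty (Fin d) := ⟨⟨0, hd⟩⟩
  have hx : Set.EqOn (fun y : ℝ => y ^ (d - 1) • (Set.Iio r).indicator (fun t : ℝ => t ^ (-α)) y)
      ((Set.Iio r).indicator (fun t : ℝ => t ^ (d - 1 - α))) (Set.Ioi 0) := by
    intro y hy
    have hy : 0 < y := hy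
    by_cases h : y < r
    · simp only [Set.indicator, Set.mem_Iio, h, if_true, smul_eq_mul]
      rw [← Real.rpow_natCast, ← Real.rpow_add hy, Nat.cast_sub hd]
      congr 1
      push_cast
      ring
    · simp [Set.indicator, h]
  have hio : IntegrableOn (fun t : ℝ => t ^ (d - 1 - α)) (Set.Ioo 0 r) := by
    rw [intervalIntegral.integrableOn_Ioo_rpow_iff hr]
    linarith
  have hset : Set.Ioi 0 ∩ Set.Iio r = Set.Ioo 0 r := Set.Ioi_inter_Iio
  have hi : Integrable (fun w : Fin d → ℝ => (Set.Iio r).indicator (fun t : ℝ => t ^ (-α)) ‖w‖) := by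
    rw [integrable_fun_norm_addHaar (volume : Measure (Fin d → ℝ))]
    rw [Module.finrank_fin_fun, integrableOn_congr_fun hx measurableSet_Ioi]
    rw [integrableOn_indicator_iff measurableSet_Iio, Set.inter_comm, hset]
    exact hio
  rw [← ofReal_integral_eq_lintegral_ofReal hi (Filter.Eventually.of_forall fun w =>
    Set.indicator_apply_nonneg (fun _ => by positivity))]
  congr 1
  rw [integral_fun_norm_addHaar (volume : Measure (Fin d → ℝ)), Module.finrank_fin_fun,
    setIntegral_congr_fun measurableSet_Ioi hx, setIntegral_indicator measurableSet_Iio, hset,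
    ← integral_Ioc_eq_integral_Ioo, ← intervalIntegral.integral_of_le hr.le,
    integral_rpow (Or.inl (by linarith)), Real.zero_rpow (by linarith)]
  simp only [nsmul_eq_mul, smul_eq_mul]
  rw [show (d : ℝ) - 1 - α + 1 = d - α by ring]
  ring

lemma ptwise (d : ℕ) (α lam : ℝ) (hα0 : 0 < α) (hlam : 0 < lam) (R : ℝ) (hR : 0 < R)
    (x y z : Fin d → ℝ) (r : ℝ) (hr : 0 < r) (hxz : torusDist d x z = 2 * r) :
    R ^ d * torusDist d y z ^ (-α) * (1 + R * torusDist d x y) ^ (-((d : ℝ) + lam))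
      ≤ r ^ (-α) * (R ^ d * (1 + R * ‖rep d y x‖) ^ (-((d : ℝ) + lam)))
        + (r ^ d)⁻¹ * (Set.Iio r).indicator (fun t : ℝ => t ^ (-α)) ‖rep d y z‖ := by
  have h0 := td_nonneg d x y
  have h1 := td_nonneg d y z
  have hind : 0 ≤ (Set.Iio r).indicator (fun t : ℝ => t ^ (-α)) ‖rep d y z‖ :=
    Set.indicator_apply_nonneg (fun _ => by positivity)
  rcases le_or_gt r (torusDist d y z) with h | h
  · have e1 : torusDist d y z ^ (-α) ≤ r ^ (-α) :=
      Real.rpow_le_rpow_of_nonpos hr h (by linarith)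
    have e2 : (1 + R * torusDist d x y) ^ (-((d : ℝ) + lam))
        ≤ (1 + R * ‖rep d y x‖) ^ (-((d : ℝ) + lam)) := by
      refine Real.rpow_le_rpow_of_nonpos (by positivity) ?_ (by
        have : (0 : ℝ) ≤ d := by positivity
        linarith)
      have := rep_le d y x
      rw [td_symm d x y]
      gcongr
    calc _ ≤ R ^ d * r ^ (-α) * (1 + R * ‖rep d y x‖) ^ (-((d : ℝ) + lam)) := by gcongr
      _ = r ^ (-α) * (R ^ d * (1 + R * ‖rep d y x‖) ^ (-((d : ℝ) + lam))) := by ring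
      _ ≤ _ := le_add_of_nonneg_right (by positivity)
  · have hxy : r ≤ torusDist d x y := by
      have := td_tri d x y z
      linarith
    have e1 : torusDist d y z ^ (-α) ≤
        (Set.Iio r).indicator (fun t : ℝ => t ^ (-α)) ‖rep d y z‖ := by
      have hle := rep_le d y z
      rw [Set.indicator_of_mem (show ‖rep d y z‖ ∈ Set.Iio r from lt_of_le_of_lt hle h)]
      rcases (norm_nonneg (rep d y z)).eq_or_lt with h2 | h2
      · rw [rep_zero d y z (norm_eq_zero.1 h2.symm), ← h2]
      · exact Real.rpow_le_rpow_of_nonpos h2 hle (by linarith)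
    have e2 : R ^ d * (1 + R * torusDist d x y) ^ (-((d : ℝ) + lam)) ≤ (r ^ d)⁻¹ := by
      have hb : 1 ≤ 1 + R * torusDist d x y := by nlinarith [mul_nonneg hR.le h0]
      have : (1 + R * torusDist d x y) ^ (-((d : ℝ) + lam)) ≤ ((R * r) ^ d)⁻¹ := by
        calc _ ≤ (1 + R * torusDist d x y) ^ (-(d : ℝ)) :=
              Real.rpow_le_rpow_of_exponent_le hb (by linarith)
          _ = ((1 + R * torusDist d x y) ^ d)⁻¹ := by
              rw [Real.rpow_neg (by linarith), Real.rpow_natCast]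
          _ ≤ _ := by
              have : R * r ≤ 1 + R * torusDist d x y := by nlinarith
              gcongr
      calc _ ≤ R ^ d * ((R * r) ^ d)⁻¹ := by gcongr
        _ = _ := by rw [mul_pow]; field_simp
    calc _ = (R ^ d * (1 + R * torusDist d x y) ^ (-((d : ℝ) + lam))) * torusDist d y z ^ (-α) := by
          ring
      _ ≤ (r ^ d)⁻¹ * (Set.Iio r).indicator (fun t : ℝ => t ^ (-α)) ‖rep d y z‖ := by gcongr
      _ ≤ _ := le_add_of_nonneg_left (by positivity)

/-- Convolution bound: for `α ∈ (0,d)` and `λ > 0`, uniformly over the scale `n ∈ ℤ` and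
distinct points `x, z` of the torus,
`∫_{T^d} 2^{dn} |y-z|^{-α} (1 + 2^n|x-y|)^{-(d+λ)} dy ≤ C |z-x|^{-α}`. -/
theorem statement2 (d : ℕ) (hd : 0 < d) (α lam : ℝ)
    (hα0 : 0 < α) (hαd : α < d) (hlam : 0 < lam) :
    ∃ C > 0, ∀ (n : ℤ) (x z : Fin d → ℝ), torusDist d x z ≠ 0 →
      (∫ y in Set.Ico (0 : Fin d → ℝ) 1,
          (2 : ℝ) ^ ((d : ℝ) * (n : ℝ)) * torusDist d y z ^ (-α) *
            (1 + (2 : ℝ) ^ ((n : ℝ)) * torusDist d x y) ^ (-((d : ℝ) + lam)))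
        ≤ C * torusDist d z x ^ (-α) := by
  set KA : ℝ := ∫ w : Fin d → ℝ, (1 + ‖w‖) ^ (-((d : ℝ) + lam)) with hKA
  set KB : ℝ := d * volume.real (Metric.ball (0 : Fin d → ℝ) 1) / (d - α) with hKB
  have hA0 : 0 ≤ KA := integral_nonneg fun w => by positivity
  have hB0 : 0 ≤ KB := div_nonneg (by positivity) (by linarith)
  refine ⟨2 ^ α * (KA + KB) + 1, by positivity, fun n x z hne => ?_⟩
  obtain ⟨r, hxz⟩ : ∃ r, torusDist d x z = 2 * r := ⟨torusDist d x z / 2, by ring⟩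
  have hr : 0 < r := by
    have := lt_of_le_of_ne (td_nonneg d x z) hne.symm
    linarith
  set R : ℝ := (2 : ℝ) ^ (n : ℝ) with hRdef
  have hR : 0 < R := by positivity
  have hRd : (2 : ℝ) ^ ((d : ℝ) * (n : ℝ)) = R ^ d := by
    rw [mul_comm, Real.rpow_mul (by norm_num), Real.rpow_natCast]
  rw [hRd, td_symm d z x, hxz]
  refine (Real.le_norm_self _).trans ((norm_integral_le_lintegral_norm _).trans ?_)
  have hfin : r ^ (-α) * KA + (r ^ d)⁻¹ * (KB * r ^ (d - α)) ≤
      (2 ^ α * (KA + KB) + 1) * (2 * r) ^ (-α) := by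
    have e1 : (r ^ d)⁻¹ * r ^ (d - α) = r ^ (-α) := by
      rw [← Real.rpow_natCast, ← Real.rpow_neg hr.le, ← Real.rpow_add hr]
      congr 1
      ring
    have e2 : r ^ (-α) = 2 ^ α * (2 * r) ^ (-α) := by
      rw [Real.mul_rpow (by norm_num) hr.le, ← mul_assoc, ← Real.rpow_add (by norm_num)]
      simp
    have e3 : 0 < (2 * r) ^ (-α) := by positivity
    calc _ = r ^ (-α) * KA + KB * ((r ^ d)⁻¹ * r ^ (d - α)) := by ring
      _ = (2 ^ α * (KA + KB)) * (2 * r) ^ (-α) := by rw [e1, e2]; ring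
      _ ≤ _ := by linarith
  refine ENNReal.toReal_le_of_le_ofReal (by positivity) (le_trans ?_ (ENNReal.ofReal_le_ofReal hfin))
  set hA : (Fin d → ℝ) → ENNReal :=
    fun w => ENNReal.ofReal (R ^ d * (1 + R * ‖w‖) ^ (-((d : ℝ) + lam))) with hhA
  set hB : (Fin d → ℝ) → ENNReal :=
    fun w => ENNReal.ofReal ((Set.Iio r).indicator (fun t : ℝ => t ^ (-α)) ‖w‖) with hhB
  have mA : Measurable hA := by
    rw [hhA]
    fun_prop
  have mB : Measurable hB := by
    have : Measurable ((Set.Iio r).indicator (fun t : ℝ => t ^ (-α))) :=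
      Measurable.indicator (by fun_prop) measurableSet_Iio
    exact (this.comp measurable_norm).ennreal_ofReal
  calc _ ≤ ∫⁻ y in Set.Ico (0 : Fin d → ℝ) 1, (ENNReal.ofReal (r ^ (-α)) * per d hA x y
          + ENNReal.ofReal ((r ^ d)⁻¹) * per d hB z y) := by
        refine lintegral_mono fun y => ?_
        have h0 := td_nonneg d x y
        have h1 := td_nonneg d y z
        rw [Real.norm_of_nonneg (by positivity)]
        refine (ENNReal.ofReal_le_ofReal
          (ptwise d α lam hα0 hlam R hR x y z r hr hxz)).trans ?_
        refine ENNReal.ofReal_add_le.trans ?_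
        rw [ENNReal.ofReal_mul (by positivity), ENNReal.ofReal_mul (p := (r ^ d)⁻¹) (by positivity)]
        exact add_le_add (mul_le_mul_right (le_per d hA x y) _)
          (mul_le_mul_right (le_per d hB z y) _)
    _ = ENNReal.ofReal (r ^ (-α)) * (∫⁻ y in Set.Ico (0 : Fin d → ℝ) 1, per d hA x y)
          + ENNReal.ofReal ((r ^ d)⁻¹) * ∫⁻ y in Set.Ico (0 : Fin d → ℝ) 1, per d hB z y := by
        rw [lintegral_add_left ((per_meas d hA mA x).const_mul _),
          lintegral_const_mul _ (per_meas d hA mA x), lintegral_const_mul _ (per_meas d hB mB z)]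
    _ ≤ ENNReal.ofReal (r ^ (-α)) * ENNReal.ofReal KA
          + ENNReal.ofReal ((r ^ d)⁻¹) * ENNReal.ofReal (KB * r ^ (d - α)) := by
        have a1 := (per_int d hA mA x).trans (le_of_eq (intA d lam hlam R hR))
        have a2 := (per_int d hB mB z).trans (le_of_eq (intB d hd α hαd r hr))
        rw [show d * volume.real (Metric.ball (0 : Fin d → ℝ) 1) * (r ^ (d - α) / (d - α))
          = KB * r ^ (d - α) by rw [hKB]; ring] at a2
        exact add_le_add (mul_le_mul_right a1 _) (mul_le_mul_right a2 _)
    _ = _ := by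
        rw [← ENNReal.ofReal_mul (by positivity), ← ENNReal.ofReal_mul (by positivity),
          ← ENNReal.ofReal_add (by positivity) (by positivity)]
end
end
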